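/- Let 𝒜 be a locally-Gorenstein Λ-order in A. Then for every finitely generated 𝒜-module M and every integer i ≥ 2, the group Ext^i_𝒜(M,𝒜) vanishes. -/

import Mathlib

/-!
Statement 1.  Let `Λ` be a Dedekind domain with fraction field `F`, `A` a finite-dimensional
`F`-algebra and `𝒜` a locally-Gorenstein `Λ`-order in `A` (see Statement 0 for the encoding
of the locally-Gorenstein condition).  Then for every finitely generated `𝒜`-module `M` and
every integer `i ≥ 2` the group `Ext^i_𝒜 (M, 𝒜)` vanishes.
-/

noncomputable section

open CategoryTheory

variable (Λ : Type) [CommRing Λ] [IsDomain Λ] [IsDedekindDomain Λ]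
variable (F : Type) [Field F] [Algebra Λ F] [IsFractionRing Λ F]
variable (A : Type) [Ring A] [Algebra F A] [FiniteDimensional F A]
  [Algebra Λ A] [IsScalarTower Λ F A]
variable (𝒜 : Subalgebra Λ A)

/-- `ι` is a `Λ`-linear anti-involution of `𝒜`. -/
def IsAntiInvolution (ι : ↥𝒜 →ₗ[Λ] ↥𝒜) : Prop :=
  (∀ x y : ↥𝒜, ι (x * y) = ι y * ι x) ∧ ∀ x : ↥𝒜, ι (ι x) = x

/-- The `Λ`-linear map `𝒜 → Hom_Λ(𝒜, Λ)`, `a ↦ a • θ`, where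
`(a • θ) (a') = θ (ι a * a')` is the `ι`-twisted left `𝒜`-action on the dual. -/
def dualActionMap (ι : ↥𝒜 →ₗ[Λ] ↥𝒜) (θ : Module.Dual Λ ↥𝒜) :
    ↥𝒜 →ₗ[Λ] Module.Dual Λ ↥𝒜 :=
  (LinearMap.llcomp Λ ↥𝒜 ↥𝒜 Λ θ).comp ((LinearMap.mul Λ ↥𝒜).comp ι)

/-- The `Λ`-order `𝒜` is locally-Gorenstein. -/
def IsLocallyGorenstein : Prop :=
  ∃ ι : ↥𝒜 →ₗ[Λ] ↥𝒜, IsAntiInvolution Λ A 𝒜 ι ∧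
    ∀ (p : Ideal Λ) [p.IsPrime],
      ∃ θ : Module.Dual Λ ↥𝒜,
        Function.Bijective (LocalizedModule.map p.primeCompl (dualActionMap Λ A 𝒜 ι θ))


theorem aux_baer_ext {R Q M N : Type} [Ring R] [AddCommGroup Q] [Module R Q]
    [AddCommGroup M] [AddCommGroup N] [Module R M] [Module R N] (hQ : Module.Baer R Q)
    (d : M →ₗ[R] N) (g : M →ₗ[R] Q) (h : ∀ x, d x = 0 → g x = 0) :
    ∃ k : N →ₗ[R] Q, ∀ x, k (d x) = g x := by
  have h' : LinearMap.ker d ≤ LinearMap.ker g := fun x hx => h x hx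
  obtain ⟨k, hk⟩ := hQ.extension_property ((LinearMap.ker d).liftQ d le_rfl)
    (LinearMap.ker_eq_bot.1 (Submodule.ker_liftQ_eq_bot _ _ _ le_rfl))
    ((LinearMap.ker d).liftQ g h')
  refine ⟨k, fun x => ?_⟩
  have := LinearMap.congr_fun hk (Submodule.Quotient.mk x)
  simpa using this

theorem aux_baer_frac (R F : Type) [CommRing R] [IsDomain R] [Field F] [Algebra R F]
    [IsFractionRing R F] : Module.Baer R F := by
  intro I g
  by_cases hI : I = ⊥
  · subst hI
    refine ⟨0, fun x hx => ?_⟩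
    have : (⟨x, hx⟩ : (⊥ : Ideal R)) = 0 := Subtype.ext (by simpa using hx)
    rw [this]; simp
  · obtain ⟨y, hy, hy0⟩ := Submodule.exists_mem_ne_zero_of_ne_bot hI
    have hyF : algebraMap R F y ≠ 0 := by
      simpa using hy0
    refine ⟨LinearMap.toSpanSingleton R F (g ⟨y, hy⟩ / algebraMap R F y), fun x hx => ?_⟩
    have e : x • g ⟨y, hy⟩ = y • g ⟨x, hx⟩ := by
      rw [← map_smul, ← map_smul]
      congr 1
      exact Subtype.ext (mul_comm _ _)
    rw [Algebra.smul_def, Algebra.smul_def] at e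
    rw [LinearMap.toSpanSingleton_apply, Algebra.smul_def, mul_div_assoc', e]
    field_simp

theorem aux_baer_quot {R Q N : Type} [CommRing R] [IsDedekindDomain R]
    [AddCommGroup Q] [Module R Q] [AddCommGroup N] [Module R N] (hQ : Module.Baer R Q)
    (q : Q →ₗ[R] N) (hq : Function.Surjective q) : Module.Baer R N := by
  intro I g
  have : Module.Finite R I := Module.Finite.of_fg (IsNoetherian.noetherian I)
  have : Module.FinitePresentation R I := Module.finitePresentation_of_finite R I
  have : Module.Projective R I := Module.Flat.projective_of_finitePresentation
  obtain ⟨g', hg'⟩ := Module.projective_lifting_property q g hq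
  obtain ⟨k, hk⟩ := hQ I g'
  refine ⟨q ∘ₗ k, fun x hx => ?_⟩
  rw [LinearMap.comp_apply, hk x hx, ← hg']; rfl

theorem aux_dual_ext (R F : Type) [CommRing R] [IsDedekindDomain R] [Field F]
    [Algebra R F] [IsFractionRing R F] {P₂ P₁ P₀ : Type}
    [AddCommGroup P₂] [AddCommGroup P₁] [AddCommGroup P₀]
    [Module R P₂] [Module R P₁] [Module R P₀] [Module.Projective R P₀]
    (d₂ : P₂ →ₗ[R] P₁) (d₁ : P₁ →ₗ[R] P₀) (hd : Function.Exact d₂ d₁)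
    (g : P₂ →ₗ[R] R) (hg : ∀ x, d₂ x = 0 → g x = 0) :
    ∃ k : P₁ →ₗ[R] R, ∀ x, k (d₂ x) = g x := by
  let a : R →ₗ[R] F := Algebra.linearMap R F
  have ha : Function.Injective a := IsFractionRing.injective R F
  obtain ⟨u, hu⟩ := aux_baer_ext (aux_baer_frac R F) d₂ (a ∘ₗ g)
    (fun x hx => by simp [hg x hx])
  let q := (LinearMap.range a).mkQ
  have hq : Function.Surjective q := Submodule.mkQ_surjective _
  obtain ⟨v, hv⟩ := aux_baer_ext (aux_baer_quot (aux_baer_frac R F) q hq) d₁ (q ∘ₗ u)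
    (fun x hx => by
      obtain ⟨y, rfl⟩ := (hd x).1 hx
      simp [q, hu])
  obtain ⟨w, hw⟩ := Module.projective_lifting_property q v hq
  have key : ∀ x, (u - w ∘ₗ d₁) x ∈ LinearMap.range a := fun x => by
    rw [← Submodule.ker_mkQ (LinearMap.range a), LinearMap.mem_ker]
    change q _ = 0
    have h1 := LinearMap.congr_fun hw (d₁ x)
    have h2 := hv x
    simp only [LinearMap.comp_apply] at h1 h2
    simp [map_sub, h1, h2]
  let e := LinearEquiv.ofInjective a ha
  refine ⟨e.symm.toLinearMap ∘ₗ (u - w ∘ₗ d₁).codRestrict (LinearMap.range a) key, fun x => ?_⟩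
  apply e.injective
  apply Subtype.ext
  simp only [LinearMap.comp_apply, LinearEquiv.coe_coe, LinearEquiv.apply_symm_apply]
  simp [e, hu, hd.apply_apply_eq_zero]

theorem aux_proj_trans {R B P : Type} [CommRing R] [Ring B] [Algebra R B] [Module.Projective R B]
    [AddCommGroup P] [Module R P] [Module B P] [IsScalarTower R B P] [Module.Projective B P] :
    Module.Projective R P := by
  obtain ⟨s, hs⟩ := Module.projective_def'.1 ‹Module.Projective B P›
  classical
  have : Module.Projective R (P →₀ B) :=
    Module.Projective.of_equiv (finsuppLequivDFinsupp (M := B) R (ι := P)).symm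
  exact Module.Projective.of_split (s.restrictScalars R)
    ((Finsupp.linearCombination B id).restrictScalars R)
    (by ext x; exact LinearMap.congr_fun hs x)

theorem aux_local {R : Type} [CommRing R] [IsDomain R] {M N : Type} [AddCommGroup M]
    [AddCommGroup N] [Module R M] [Module R N] [Module.IsTorsionFree R M] [Module.Finite R N]
    (p : Ideal R) [p.IsPrime] (φ : M →ₗ[R] N)
    (h : Function.Bijective (LocalizedModule.map p.primeCompl φ)) :
    Function.Injective φ ∧ ∃ s : R, s ∉ p ∧ ∀ n, ∃ m, φ m = s • n := by
  have hmk : ∀ m s, LocalizedModule.map p.primeCompl φ (LocalizedModule.mk m s)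
    = LocalizedModule.mk (φ m) s := fun m s => IsLocalizedModule.map_LocalizedModules _ _ _ _
  constructor
  · rw [injective_iff_map_eq_zero]
    intro m hm
    have h1 : LocalizedModule.mk m (1 : p.primeCompl) = 0 := by
      apply h.1
      rw [hmk, hm, map_zero, LocalizedModule.zero_mk]
    rw [← LocalizedModule.zero_mk (1 : p.primeCompl), LocalizedModule.mk_eq] at h1
    obtain ⟨u, hu⟩ := h1
    simp only [one_smul, smul_zero] at hu
    have hu' : (u : R) • m = 0 := hu
    exact (smul_eq_zero.1 hu').resolve_left (fun h0 => u.2 (h0 ▸ p.zero_mem))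
  · have loc : ∀ n, ∃ s : R, s ∉ p ∧ ∃ m, φ m = s • n := by
      intro n
      obtain ⟨z, hz⟩ := h.2 (LocalizedModule.mk n 1)
      induction z with
      | _ m s =>
      rw [hmk, LocalizedModule.mk_eq] at hz
      obtain ⟨u, hu⟩ := hz
      refine ⟨u * s, p.primeCompl.mul_mem u.2 s.2, (u : R) • m, ?_⟩
      rw [map_smul, mul_smul]
      simpa [Submonoid.smul_def] using hu
    suffices H : ∀ S : Submodule R N, S.FG → ∃ s : R, s ∉ p ∧ ∀ n ∈ S, ∃ m, φ m = s • n by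
      obtain ⟨s, hs, h⟩ := H ⊤ Module.Finite.fg_top
      exact ⟨s, hs, fun n => h n trivial⟩
    intro S hS
    induction S, hS using Submodule.fg_induction with
    | singleton n =>
      obtain ⟨s, hs, m, hm⟩ := loc n
      refine ⟨s, hs, fun x hx => ?_⟩
      obtain ⟨c, rfl⟩ := Submodule.mem_span_singleton.1 hx
      exact ⟨c • m, by rw [map_smul, hm, smul_comm]⟩
    | sup S T hS hT h1 h2 =>
      obtain ⟨s, hs, h1⟩ := h1
      obtain ⟨t, ht, h2⟩ := h2
      refine ⟨s * t, p.primeCompl.mul_mem hs ht, fun x hx => ?_⟩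
      obtain ⟨y, hy, z, hz, rfl⟩ := Submodule.mem_sup.1 hx
      obtain ⟨m, hm⟩ := h1 y hy
      obtain ⟨m', hm'⟩ := h2 z hz
      exact ⟨t • m + s • m', by
        rw [map_add, map_smul, map_smul, hm, hm', smul_add, smul_smul, smul_smul, mul_comm t s]⟩

theorem aux_core {R B : Type} [CommRing R] [Ring B] [Algebra R B] (ι : B →ₗ[R] B)
    (hmul : ∀ x y, ι (x * y) = ι y * ι x) (hinv : ∀ x, ι (ι x) = x)
    (θ : B →ₗ[R] R) (φ : B →ₗ[R] Module.Dual R B) (hφ : ∀ a b, φ a b = θ (ι a * b))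
    (hinj : Function.Injective φ) (s : R) (hs : ∀ n, ∃ m, φ m = s • n)
    {P₂ P₁ : Type} [AddCommGroup P₂] [AddCommGroup P₁] [Module R P₂] [Module R P₁]
    [Module B P₂] [Module B P₁] [IsScalarTower R B P₂] [IsScalarTower R B P₁]
    (d : P₂ →ₗ[B] P₁) (f : P₂ →ₗ[B] B) (g : P₁ →ₗ[R] R) (hg : ∀ x, g (d x) = θ (ι (f x))) :
    ∃ k : P₁ →ₗ[B] B, ∀ x, k (d x) = s • f x := by
  let h (x : P₁) : Module.Dual R B :=
    { toFun := fun a => g (ι a • x)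
      map_add' := fun a b => by rw [map_add, add_smul, map_add]
      map_smul' := fun r a => by
        rw [ι.map_smul, smul_assoc, g.map_smul]; rfl }
  choose k hk using fun x => hs (h x)
  have hk' : ∀ x a, θ (ι (k x) * a) = s * g (ι a • x) := fun x a => by
    rw [← hφ, hk]; rfl
  refine ⟨⟨⟨k, fun x y => ?_⟩, fun b x => ?_⟩, fun x => ?_⟩
  · apply hinj
    ext a
    simp only [hφ, hk', smul_add, mul_add, φ.map_add, LinearMap.add_apply, g.map_add]
  · apply hinj
    ext a
    simp only [hφ, hk', RingHom.id_apply, smul_eq_mul, hmul, mul_assoc]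
    rw [hinv, mul_smul]
  · apply hinj
    ext a
    change φ (k (d x)) a = _
    rw [hφ, hk', ← d.map_smul, hg, f.map_smul, smul_eq_mul, hmul, hinv, φ.map_smul,
      LinearMap.smul_apply, hφ, smul_eq_mul]

theorem aux_glue {R B : Type} [CommRing R] [Ring B] [Algebra R B]
    {P₂ P₁ : Type} [AddCommGroup P₂] [AddCommGroup P₁]
    [Module B P₂] [Module B P₁] (d : P₂ →ₗ[B] P₁) (f : P₂ →ₗ[B] B)
    (H : ∀ (p : Ideal R) [p.IsPrime], ∃ s : R, s ∉ p ∧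
      ∃ k : P₁ →ₗ[B] B, ∀ x, k (d x) = s • f x) :
    ∃ k : P₁ →ₗ[B] B, ∀ x, k (d x) = f x := by
  let I : Ideal R :=
    { carrier := {s | ∃ k : P₁ →ₗ[B] B, ∀ x, k (d x) = s • f x}
      add_mem' := by
        rintro s t ⟨k, hk⟩ ⟨l, hl⟩
        exact ⟨k + l, fun x => by rw [LinearMap.add_apply, hk, hl, add_smul]⟩
      zero_mem' := ⟨0, fun x => by simp⟩
      smul_mem' := by
        rintro c s ⟨k, hk⟩
        refine ⟨LinearMap.toSpanSingleton B B (algebraMap R B c) ∘ₗ k, fun x => ?_⟩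
        rw [LinearMap.comp_apply, hk, LinearMap.toSpanSingleton_apply, smul_eq_mul,
          ← Algebra.commutes, ← Algebra.smul_def, smul_smul, smul_eq_mul] }
  have hI : I = ⊤ := by
    by_contra hne
    obtain ⟨p, hp, hle⟩ := Ideal.exists_le_maximal I hne
    obtain ⟨s, hs, k, hk⟩ := H p
    exact hs (hle ⟨k, hk⟩)
  obtain ⟨k, hk⟩ : (1 : R) ∈ I := hI ▸ trivial
  exact ⟨k, fun x => by rw [hk, one_smul]⟩

theorem aux_main (Λ : Type) [CommRing Λ] [IsDomain Λ] [IsDedekindDomain Λ]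
    (F : Type) [Field F] [Algebra Λ F] [IsFractionRing Λ F]
    (A : Type) [Ring A] [Algebra F A] [Algebra Λ A] [IsScalarTower Λ F A]
    (𝒜 : Subalgebra Λ A) [Module.Finite Λ 𝒜] (hLG : IsLocallyGorenstein Λ A 𝒜)
    {P₂ P₁ P₀ : Type} [AddCommGroup P₂] [AddCommGroup P₁] [AddCommGroup P₀]
    [Module 𝒜 P₂] [Module 𝒜 P₁] [Module 𝒜 P₀] [Module.Projective 𝒜 P₀]
    (d₂ : P₂ →ₗ[𝒜] P₁) (d₁ : P₁ →ₗ[𝒜] P₀) (hd : Function.Exact d₂ d₁)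
    (f : P₂ →ₗ[𝒜] 𝒜) (hf : ∀ x, d₂ x = 0 → f x = 0) :
    ∃ k : P₁ →ₗ[𝒜] 𝒜, ∀ x, k (d₂ x) = f x := by
  let _ : Module Λ P₂ := Module.compHom P₂ (algebraMap Λ 𝒜)
  let _ : Module Λ P₁ := Module.compHom P₁ (algebraMap Λ 𝒜)
  let _ : Module Λ P₀ := Module.compHom P₀ (algebraMap Λ 𝒜)
  have : IsScalarTower Λ 𝒜 P₂ := IsScalarTower.of_algebraMap_smul fun _ _ => rfl
  have : IsScalarTower Λ 𝒜 P₁ := IsScalarTower.of_algebraMap_smul fun _ _ => rfl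
  have : IsScalarTower Λ 𝒜 P₀ := IsScalarTower.of_algebraMap_smul fun _ _ => rfl
  have : Module.IsTorsionFree Λ A := Module.IsTorsionFree.trans F
  have : Module.IsTorsionFree Λ 𝒜 :=
    Function.Injective.moduleIsTorsionFree (Subtype.val : 𝒜 → A) Subtype.val_injective
      (fun _ _ => rfl)
  have : Module.FinitePresentation Λ 𝒜 := Module.finitePresentation_of_finite Λ 𝒜
  have : Module.Projective Λ 𝒜 := Module.Flat.projective_of_finitePresentation
  have : Module.Projective Λ P₀ := aux_proj_trans (B := 𝒜)
  obtain ⟨ι, ⟨hmul, hinv⟩, H⟩ := hLG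
  refine aux_glue (R := Λ) d₂ f fun p _ => ?_
  obtain ⟨θ, hθ⟩ := H p
  obtain ⟨hinj, s, hs, hsur⟩ := aux_local p _ hθ
  obtain ⟨g, hg⟩ := aux_dual_ext Λ F (d₂.restrictScalars Λ) (d₁.restrictScalars Λ) hd
    (θ ∘ₗ ι ∘ₗ f.restrictScalars Λ) (fun x hx => by simp [hf x hx])
  exact ⟨s, hs, aux_core ι hmul hinv θ _ (fun a b => rfl) hinj s hsur d₂ f g hg⟩

/-- If `𝒜` is a locally-Gorenstein `Λ`-order, then `Ext^i_𝒜 (M, 𝒜) = 0` for every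
finitely generated `𝒜`-module `M` and every `i ≥ 2`. -/
theorem locallyGorenstein_ext_vanishing
    [Module.Finite Λ ↥𝒜] (hspan : Submodule.span F (𝒜 : Set A) = ⊤)
    (hLG : IsLocallyGorenstein Λ A 𝒜)
    (M : Type) [AddCommGroup M] [Module ↥𝒜 M] [Module.Finite ↥𝒜 M]
    (i : ℕ) (hi : 2 ≤ i) :
    Subsingleton
      (((Ext ℤ (ModuleCat ↥𝒜) i).obj
          (Opposite.op (ModuleCat.of ↥𝒜 M))).obj (ModuleCat.of ↥𝒜 ↥𝒜)) := by
  obtain ⟨n, rfl⟩ : ∃ n, i = n + 2 := ⟨i - 2, by omega⟩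
  let P := projectiveResolution (ModuleCat.of ↥𝒜 M)
  have hz : Limits.IsZero (((Ext ℤ (ModuleCat ↥𝒜) (n + 2)).obj
          (Opposite.op (ModuleCat.of ↥𝒜 M))).obj (ModuleCat.of ↥𝒜 ↥𝒜)) := by
    refine Limits.IsZero.of_iso ?_ (P.isoExt (n + 2) (ModuleCat.of ↥𝒜 ↥𝒜))
    rw [← HomologicalComplex.exactAt_iff_isZero_homology,
      HomologicalComplex.exactAt_iff' _ (n + 1) (n + 2) (n + 3) (by simp) (by simp),
      ShortComplex.moduleCat_exact_iff]
    intro (f : P.complex.X (n + 2) ⟶ ModuleCat.of ↥𝒜 ↥𝒜) hf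
    have hf' : P.complex.d (n + 3) (n + 2) ≫ f = 0 := hf
    have e1 := (ShortComplex.ShortExact.moduleCat_exact_iff_function_exact _).1 (P.exact_succ n)
    have e2 := (ShortComplex.ShortExact.moduleCat_exact_iff_function_exact _).1
      (P.exact_succ (n + 1))
    have : Module.Projective ↥𝒜 (P.complex.X n) :=
      ModuleCat.projective_of_module_projective _
    obtain ⟨k, hk⟩ := aux_main Λ F A 𝒜 hLG (P.complex.d (n + 2) (n + 1)).hom
      (P.complex.d (n + 1) n).hom e1 f.hom (fun x hx => by
        obtain ⟨y, rfl⟩ := (e2 x).1 hx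
        exact LinearMap.congr_fun (congrArg ModuleCat.Hom.hom hf') y)
    refine ⟨(ModuleCat.ofHom k : P.complex.X (n + 1) ⟶ ModuleCat.of ↥𝒜 ↥𝒜), ?_⟩
    change P.complex.d (n + 2) (n + 1) ≫ ModuleCat.ofHom k = f
    ext x
    exact congrArg Subtype.val (hk x)
  exact ModuleCat.subsingleton_of_isZero hz

end
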